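/- Abelian asymptotics for the Laplace transform of a regularly varying tail: let (Y,μ) be a probability space, φ : Y → {1,2,3,…} measurable with μ(φ > n) = ℓ(n)n^{−β} for all n ≥ 1, where β ∈ (0,1) and ℓ is slowly varying. Suppose that for each u ∈ (0,u₀) a measurable function g_u : [0,∞) → ℝ is given with sup_{x≥0} |g_u(x) − 1| → 0 as u → 0⁺. Then u ∫_0^∞ e^{−ux} g_u(x) μ(φ > x) dx = Γ(1−β) ℓ(1/u) u^{β} (1 + o(1)) as u → 0⁺. In particular (taking g_u ≡ 1), 1 − ∫_Y e^{−uφ} dμ ∼ Γ(1−β) ℓ(1/u) u^{β} as u → 0⁺. -/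

import Mathlib

open MeasureTheory Filter Topology

/-- `l` is slowly varying: measurable, bounded above and below by positive constants on
each compact subset of `(0,∞)`, and `l (λ x)/ l x → 1` as `x → ∞` for every `λ > 0`. -/
def SlowlyVarying (l : ℝ → ℝ) : Prop :=
  Measurable l ∧
  (∀ K : Set ℝ, IsCompact K → K ⊆ Set.Ioi 0 →
    ∃ c C : ℝ, 0 < c ∧ ∀ x ∈ K, c ≤ l x ∧ l x ≤ C) ∧
  ∀ lam : ℝ, 0 < lam → Tendsto (fun x => l (lam * x) / l x) atTop (𝓝 1)

open Set in
/-- uniform convergence theorem, sequential additive form -/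
theorem uct_seq (h : ℝ → ℝ) (hm : Measurable h)
    (hh : ∀ s : ℝ, Tendsto (fun t => h (t + s) - h t) atTop (𝓝 0))
    (x s : ℕ → ℝ) (hx : Tendsto x atTop atTop) (hs : ∀ n, s n ∈ Icc (0:ℝ) 1) :
    Tendsto (fun n => h (x n + s n) - h (x n)) atTop (𝓝 0) := by
  have key : ∀ (z : ℕ → ℝ), Tendsto z atTop atTop → ∀ ε > 0, ∀ᶠ n in atTop,
      ENNReal.ofReal (3/2) < volume ({w : ℝ | |h (z n + w) - h (z n)| < ε} ∩ Icc 0 2) := by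
    intro z hz ε hε
    let V : ℕ → Set ℝ := fun n => {w : ℝ | ∀ m ≥ n, |h (z m + w) - h (z m)| < ε} ∩ Icc 0 2
    have hVmono : Monotone V := by
      intro a b hab w hw
      exact ⟨fun m hm' => hw.1 m (le_trans hab hm'), hw.2⟩
    have hU : ⋃ n, V n = Icc 0 2 := by
      ext w
      simp only [mem_iUnion]
      constructor
      · rintro ⟨n, hn⟩; exact hn.2
      · intro hw
        have h1 := ((hh w).comp hz)
        rw [Metric.tendsto_atTop] at h1
        obtain ⟨N, hN⟩ := h1 ε hε
        refine ⟨N, fun m hm' => ?_, hw⟩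
        have := hN m hm'
        simpa [Real.dist_eq] using this
    have h2 := tendsto_measure_iUnion_atTop (μ := (volume : Measure ℝ)) hVmono
    rw [hU, Real.volume_Icc] at h2
    have h3 : ENNReal.ofReal (3/2) < ENNReal.ofReal (2 - 0) := by
      rw [ENNReal.ofReal_lt_ofReal_iff] <;> norm_num
    filter_upwards [h2.eventually (lt_mem_nhds h3)] with n hn
    refine lt_of_lt_of_le hn (measure_mono ?_)
    intro w hw
    exact ⟨hw.1 n le_rfl, hw.2⟩
  rw [Metric.tendsto_nhds]
  intro ε hε
  have hxs : Tendsto (fun n => x n + s n) atTop atTop :=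
    tendsto_atTop_add_right_of_le _ 0 hx (fun n => (hs n).1)
  filter_upwards [key x hx (ε/2) (by positivity), key _ hxs (ε/2) (by positivity)] with n h1 h2
  set A := {w : ℝ | |h (x n + w) - h (x n)| < ε/2} ∩ Icc 0 2
  set B := {w : ℝ | |h (x n + s n + w) - h (x n + s n)| < ε/2} ∩ Icc 0 2
  have hB : MeasurableSet B := by
    refine MeasurableSet.inter ?_ measurableSet_Icc
    refine measurableSet_lt ?_ measurable_const
    have : Measurable (fun w => h (x n + s n + w)) := hm.comp (measurable_const_add _)
    exact continuous_abs.measurable.comp (this.sub_const _)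
  have hne : (A ∩ ((fun w => - s n + w) ⁻¹' B)).Nonempty := by
    by_contra hcon
    rw [not_nonempty_iff_eq_empty, ← disjoint_iff_inter_eq_empty] at hcon
    have h3 := measure_union (μ := (volume : Measure ℝ)) hcon (hB.preimage (measurable_const_add _))
    rw [measure_preimage_add] at h3
    have h4 : volume (A ∪ ((fun w => - s n + w) ⁻¹' B)) ≤ volume (Icc (0:ℝ) 3) := by
      apply measure_mono
      rintro w (hw | hw)
      · exact ⟨hw.2.1, by linarith [hw.2.2]⟩
      · have := hw.2.1
        have := hw.2.2
        have := hs n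
        simp only [mem_Icc] at *
        constructor <;> linarith
    rw [h3, Real.volume_Icc] at h4
    have h5 := ENNReal.add_lt_add h1 h2
    rw [← ENNReal.ofReal_add (by norm_num) (by norm_num)] at h5
    have h6 := lt_of_lt_of_le h5 h4
    norm_num at h6
  obtain ⟨w, hwA, hwB⟩ := hne
  have e1 := hwA.1
  have e2 := hwB.1
  simp only [mem_setOf_eq] at e1 e2
  rw [show x n + s n + (- s n + w) = x n + w by ring] at e2
  rw [Real.dist_eq, sub_zero]
  rw [abs_lt] at *
  constructor <;> linarith

theorem sv_pos {l : ℝ → ℝ} (hl : SlowlyVarying l) {x : ℝ} (hx : 0 < x) : 0 < l x := by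
  obtain ⟨c, C, hc, h⟩ := hl.2.1 {x} isCompact_singleton (by simpa using hx)
  exact lt_of_lt_of_le hc (h x rfl).1

theorem sv_floor {l : ℝ → ℝ} (hl : SlowlyVarying l) :
    Tendsto (fun x : ℝ => l x / l (⌊x⌋₊ : ℝ)) atTop (𝓝 1) := by
  apply tendsto_of_seq_tendsto
  intro x hx
  let h : ℝ → ℝ := fun t => Real.log (l (Real.exp t))
  have hm : Measurable h := Real.measurable_log.comp (hl.1.comp Real.measurable_exp)
  have hh : ∀ s : ℝ, Tendsto (fun t => h (t + s) - h t) atTop (𝓝 0) := by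
    intro s
    have h1 := (hl.2.2 (Real.exp s) (Real.exp_pos s)).comp Real.tendsto_exp_atTop
    have h2 := ((Real.continuousAt_log one_ne_zero).tendsto.comp h1)
    rw [Real.log_one] at h2
    refine h2.congr (fun t => ?_)
    simp only [Function.comp, h]
    rw [Real.log_div (sv_pos hl (by positivity)).ne' (sv_pos hl (by positivity)).ne', add_comm t s,
      Real.exp_add]
  let z : ℕ → ℝ := fun n => Real.log (⌊x n⌋₊ : ℝ)
  let s : ℕ → ℝ := fun n => if 1 ≤ x n then Real.log (x n) - Real.log (⌊x n⌋₊ : ℝ) else 0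
  have hz : Tendsto z atTop atTop :=
    Real.tendsto_log_atTop.comp (tendsto_natCast_atTop_atTop.comp (tendsto_nat_floor_atTop.comp hx))
  have hs : ∀ n, s n ∈ Set.Icc (0:ℝ) 1 := by
    intro n
    simp only [s]
    split_ifs with h1
    · have hf : (1:ℝ) ≤ (⌊x n⌋₊ : ℝ) := by exact_mod_cast Nat.one_le_floor_iff _ |>.2 h1
      have hf2 : (⌊x n⌋₊ : ℝ) ≤ x n := Nat.floor_le (by linarith)
      have hf3 : x n < (⌊x n⌋₊ : ℝ) + 1 := Nat.lt_floor_add_one _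
      constructor
      · have := Real.log_le_log (by linarith) hf2
        linarith
      · rw [← Real.log_div (by linarith) (by linarith)]
        have h3 := Real.log_le_sub_one_of_pos (x := x n / (⌊x n⌋₊ : ℝ)) (by positivity)
        have h4 : x n / (⌊x n⌋₊ : ℝ) ≤ 2 := by
          rw [div_le_iff₀ (by linarith)]; linarith
        linarith
    · simp
  have h1 := uct_seq h hm hh z s hz hs
  have h2 := (Real.continuous_exp.tendsto 0).comp h1
  rw [Real.exp_zero] at h2
  refine h2.congr' ?_
  filter_upwards [hx.eventually_ge_atTop 1] with n hn
  have hf : (1:ℝ) ≤ (⌊x n⌋₊ : ℝ) := by exact_mod_cast Nat.one_le_floor_iff _ |>.2 hn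
  simp only [Function.comp, h, z, s, if_pos hn, add_sub_cancel]
  rw [Real.exp_log (by linarith), Real.exp_log (by linarith), Real.exp_sub,
    Real.exp_log (sv_pos hl (by linarith)), Real.exp_log (sv_pos hl (by linarith))]

/-- Potter-type bound for a monotone tail. -/
theorem potter (T : ℝ → ℝ) (hT : Antitone T) (hpos : ∀ x, 0 < T x) (h1 : ∀ x, T x ≤ 1)
    (γ : ℝ) (hγ : 0 < γ) (X : ℝ) (hX : 0 < X)
    (hd : ∀ x, X ≤ x → T (x / 2) ≤ 2 ^ γ * T x) :
    ∃ C : ℝ, 0 < C ∧ ∀ x, X ≤ x → ∀ y, 0 < y → T (y * x) ≤ C * y ^ (-γ) * T x + T x := by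
  let G : ℝ → ℝ := fun x => x ^ γ * T x
  set C : ℝ := 2 ^ γ + (2 * X) ^ γ / (X ^ γ * T (2 * X)) with hC
  have hT2 := hpos (2 * X)
  have hCpos : 0 < C := by positivity
  have ind : ∀ n : ℕ, ∀ x, X ≤ x → x ≤ 2 ^ (n + 1) * X → ∀ z, 0 < z → z ≤ x → G z ≤ C * G x := by
    intro n
    have base : ∀ x, X ≤ x → x ≤ 2 * X → ∀ z, 0 < z → z ≤ x → G z ≤ C * G x := by
      intro x hx1 hx2 z hz hzx
      have a1 : G z ≤ (2 * X) ^ γ := by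
        calc z ^ γ * T z ≤ (2 * X) ^ γ * 1 := by
              gcongr
              · exact (hpos z).le
              · linarith
              · exact h1 z
          _ = _ := mul_one _
      have a2 : X ^ γ * T (2 * X) ≤ G x := by
        have := hT hx2
        have hx0 : 0 < x := by linarith
        simp only [G]
        gcongr
      have a3 : (2 * X) ^ γ ≤ C * (X ^ γ * T (2 * X)) := by
        rw [hC, add_mul, div_mul_cancel₀ _ (by positivity)]
        have : 0 ≤ (2:ℝ) ^ γ * (X ^ γ * T (2 * X)) := by positivity
        linarith
      calc G z ≤ _ := a1
        _ ≤ _ := a3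
        _ ≤ _ := by gcongr
    induction n with
    | zero => simpa using base
    | succ n ih =>
      intro x hx1 hx2 z hz hzx
      by_cases hx : x ≤ 2 * X
      · exact base x hx1 hx z hz hzx
      push Not at hx
      have hxp : 0 < x := by linarith
      have hTx := hpos x
      by_cases hzz : z ≤ x / 2
      · have b1 := ih (x / 2) (by linarith) (by rw [pow_succ] at hx2; linarith) z hz hzz
        have b2 : G (x / 2) ≤ G x := by
          simp only [G]
          rw [Real.div_rpow hxp.le (by norm_num), div_mul_eq_mul_div, div_le_iff₀ (by positivity)]
          have := mul_le_mul_of_nonneg_left (hd x hx1) (Real.rpow_nonneg hxp.le γ)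
          linarith
        exact b1.trans (by gcongr)
      · push Not at hzz
        have b1 : T z ≤ 2 ^ γ * T x := (hT hzz.le).trans (hd x hx1)
        calc G z ≤ x ^ γ * (2 ^ γ * T x) := by
              simp only [G]
              have := hpos z
              gcongr
          _ = 2 ^ γ * G x := by simp only [G]; ring
          _ ≤ C * G x := by
              have : 0 ≤ G x := by simp only [G]; positivity
              gcongr
              rw [hC]
              have : 0 ≤ (2 * X) ^ γ / (X ^ γ * T (2 * X)) := by positivity
              linarith
  refine ⟨C, hCpos, fun x hx y hy => ?_⟩
  have hTx := hpos x
  have hxp : 0 < x := by linarith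
  by_cases hy1 : y ≤ 1
  · obtain ⟨n, hn⟩ := pow_unbounded_of_one_lt (x / X) (one_lt_two (α := ℝ))
    rw [div_lt_iff₀ hX] at hn
    have h2 := ind n x hx (by rw [pow_succ]; nlinarith [hn, pow_pos (two_pos (α := ℝ)) n]) (y * x)
      (by positivity) (by nlinarith)
    simp only [G] at h2
    rw [Real.mul_rpow hy.le hxp.le] at h2
    have h3 : y ^ γ * T (y * x) ≤ C * T x := by
      have : 0 < x ^ γ := by positivity
      by_contra! hcon
      nlinarith
    rw [Real.rpow_neg hy.le]
    have hyp : 0 < y ^ γ := by positivity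
    have : T (y * x) ≤ C * T x / y ^ γ := by
      rw [le_div_iff₀ hyp]; linarith
    have e : C * (y ^ γ)⁻¹ * T x = C * T x / y ^ γ := by field_simp
    linarith
  · push Not at hy1
    have h2 : T (y * x) ≤ T x := hT (by nlinarith)
    have : 0 ≤ C * y ^ (-γ) * T x := by positivity
    linarith

theorem core (T : ℝ → ℝ) (hT : Antitone T) (hpos : ∀ x, 0 < T x) (h1 : ∀ x, T x ≤ 1)
    (β : ℝ) (hβ1 : 0 < β) (hβ2 : β < 1)
    (hreg : ∀ y, 0 < y → Tendsto (fun x => T (y * x) / T x) atTop (𝓝 (y ^ (-β))))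
    (u₀ : ℝ) (hu₀ : 0 < u₀)
    (g : ℝ → ℝ → ℝ)
    (hg_meas : ∀ u : ℝ, 0 < u → u < u₀ → Measurable (g u))
    (hg_sup : ∀ δ : ℝ, 0 < δ → ∃ u₁ : ℝ, 0 < u₁ ∧
      ∀ u : ℝ, 0 < u → u < u₁ → ∀ x : ℝ, 0 ≤ x → |g u x - 1| ≤ δ) :
    Tendsto (fun u : ℝ => (u * ∫ x in Set.Ioi (0 : ℝ), Real.exp (-(u * x)) * g u x * T x) / T (1/u))
      (𝓝[>] (0 : ℝ)) (𝓝 (Real.Gamma (1 - β))) := by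
  have hinv : Tendsto (fun u : ℝ => 1 / u) (𝓝[>] (0 : ℝ)) atTop := by
    simpa using tendsto_inv_nhdsGT_zero (𝕜 := ℝ)
  obtain ⟨γ, hγ1, hγ2⟩ := exists_between hβ2
  have hγ : 0 < γ := by linarith
  obtain ⟨X, hX, hd⟩ : ∃ X : ℝ, 0 < X ∧ ∀ x, X ≤ x → T (x / 2) ≤ 2 ^ γ * T x := by
    have h2 := hreg (1/2) (by norm_num)
    have h3 : ((1:ℝ)/2) ^ (-β) < 2 ^ γ := by
      rw [one_div, Real.inv_rpow (by norm_num), Real.rpow_neg (by norm_num), inv_inv]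
      exact Real.rpow_lt_rpow_of_exponent_lt (by norm_num) hγ1
    obtain ⟨X, hX⟩ := eventually_atTop.1 (h2.eventually (gt_mem_nhds h3))
    refine ⟨max X 1, by positivity, fun x hx => ?_⟩
    have h4 := hX x (le_trans (le_max_left _ _) hx)
    rw [div_lt_iff₀ (hpos x)] at h4
    rw [show x / 2 = 1 / 2 * x by ring]
    exact h4.le
  obtain ⟨C, hC, hpot⟩ := potter T hT hpos h1 γ hγ X hX hd
  obtain ⟨u₁, hu₁, hg1⟩ := hg_sup 1 one_pos
  have hsmall : ∀ a : ℝ, 0 < a → ∀ᶠ u in 𝓝[>] (0:ℝ), u < a := fun a ha =>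
    nhdsWithin_le_nhds (gt_mem_nhds ha)
  have hposu : ∀ᶠ u in 𝓝[>] (0:ℝ), 0 < u := self_mem_nhdsWithin
  rw [Real.Gamma_eq_integral (by linarith)]
  have hdom : Tendsto (fun u : ℝ => ∫ y in Set.Ioi (0 : ℝ),
      Real.exp (-y) * g u (u⁻¹ * y) * (T (y * (1 / u)) / T (1/u)))
      (𝓝[>] (0 : ℝ)) (𝓝 (∫ x in Set.Ioi (0:ℝ), Real.exp (-x) * x ^ (1 - β - 1))) := by
    refine tendsto_integral_filter_of_dominated_convergence
      (fun y => 2 * C * (Real.exp (-y) * y ^ (1 - γ - 1)) + 2 * (Real.exp (-y) * y ^ ((1:ℝ) - 1)))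
      ?_ ?_ ?_ ?_
    · filter_upwards [hposu, hsmall u₀ hu₀] with u hu hu'
      apply Measurable.aestronglyMeasurable
      have m1 : Measurable (fun y => g u (u⁻¹ * y)) :=
        (hg_meas u hu hu').comp (measurable_const_mul _)
      have m2 : Measurable (fun y => T (y * (1 / u))) :=
        hT.measurable.comp (measurable_mul_const _)
      exact ((by fun_prop : Measurable (fun y : ℝ => Real.exp (-y))).mul m1).mul (m2.div_const _)
    · filter_upwards [hposu, hsmall u₁ hu₁, hinv.eventually_ge_atTop X] with u hu hu' huX
      refine (ae_restrict_mem measurableSet_Ioi).mono (fun y hy => ?_)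
      have hy : 0 < y := hy
      have hg' := hg1 u hu hu' (u⁻¹ * y) (by positivity)
      have hg2 : |g u (u⁻¹ * y)| ≤ 2 := by
        rw [abs_le] at *; constructor <;> linarith
      have hp := hpot (1/u) huX y hy
      have hTu := hpos (1/u)
      have hTy := hpos (y * (1/u))
      have hq : T (y * (1 / u)) / T (1/u) ≤ C * y ^ (-γ) + 1 := by
        rw [div_le_iff₀ hTu]; linarith
      rw [norm_mul, norm_mul, Real.norm_eq_abs, Real.norm_eq_abs, Real.norm_eq_abs,
        abs_of_pos (Real.exp_pos _), abs_of_pos (div_pos hTy hTu)]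
      calc Real.exp (-y) * |g u (u⁻¹ * y)| * (T (y * (1 / u)) / T (1/u))
          ≤ Real.exp (-y) * 2 * (C * y ^ (-γ) + 1) := by gcongr
        _ = _ := by
          rw [show (1:ℝ) - γ - 1 = -γ by ring, sub_self, Real.rpow_zero]; ring
    · exact ((Real.GammaIntegral_convergent (by linarith : (0:ℝ) < 1 - γ)).const_mul _).add
        ((Real.GammaIntegral_convergent one_pos).const_mul _)
    · refine (ae_restrict_mem measurableSet_Ioi).mono (fun y hy => ?_)
      have hy : 0 < y := hy
      have t1 : Tendsto (fun u => g u (u⁻¹ * y)) (𝓝[>] (0:ℝ)) (𝓝 1) := by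
        rw [Metric.tendsto_nhds]
        intro ε hε
        obtain ⟨u₂, hu₂, hg2⟩ := hg_sup (ε/2) (by positivity)
        filter_upwards [hposu, hsmall u₂ hu₂] with u hu hu'
        rw [Real.dist_eq]
        exact lt_of_le_of_lt (hg2 u hu hu' _ (by positivity)) (by linarith)
      have t2 := (hreg y hy).comp hinv
      have t3 := (t1.const_mul (Real.exp (-y))).mul t2
      rw [show (1:ℝ) - β - 1 = -β by ring]
      simpa using t3
  refine hdom.congr' ?_
  filter_upwards [hposu] with u hu
  have cv := integral_comp_mul_left_Ioi (fun x => Real.exp (-(u * x)) * g u x * T x) 0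
    (inv_pos.2 hu)
  rw [mul_zero, inv_inv, smul_eq_mul] at cv
  rw [← cv, ← integral_div]
  congr 1
  ext y
  rw [mul_inv_cancel_left₀ hu.ne', show y * (1 / u) = u⁻¹ * y by field_simp]
  ring

theorem laplace_tail {Y : Type*} [MeasurableSpace Y] (μ : Measure Y) [IsProbabilityMeasure μ]
    (φ : Y → ℕ) (hφmeas : Measurable φ) (u : ℝ) (hu : 0 < u) :
    1 - ∫ y, Real.exp (-(u * (φ y : ℝ))) ∂μ =
      u * ∫ x in Set.Ioi (0 : ℝ), Real.exp (-(u * x)) * 1 * (μ {y | x < (φ y : ℝ)}).toReal := by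
  have hφr : Measurable (fun y => (φ y : ℝ)) := measurable_from_top.comp hφmeas
  have hlc := lintegral_comp_eq_lintegral_meas_lt_mul μ (f := fun y => (φ y : ℝ))
    (g := fun x => u * Real.exp (-(u * x))) (ae_of_all _ (fun y => Nat.cast_nonneg _))
    hφr.aemeasurable (fun t _ => Continuous.intervalIntegrable (by fun_prop) _ _)
    (ae_of_all _ (fun t => by positivity))
  have hprim : ∀ a : ℝ, ∫ t in (0:ℝ)..a, u * Real.exp (-(u * t)) = 1 - Real.exp (-(u * a)) := by
    intro a
    rw [intervalIntegral.integral_eq_sub_of_hasDerivAt (f := fun t => - Real.exp (-(u * t)))]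
    · simp; ring
    · intro x _
      have h0 : HasDerivAt (fun t : ℝ => -(u * t)) (-(u * 1)) x :=
        ((hasDerivAt_id x).const_mul u).neg
      have h1 : HasDerivAt (fun t : ℝ => - Real.exp (-(u * t)))
        (-(Real.exp (-(u * x)) * -(u * 1))) x := h0.exp.neg
      have e : u * Real.exp (-(u * x)) = -(Real.exp (-(u * x)) * -(u * 1)) := by ring
      rw [e]
      exact h1
    · exact Continuous.intervalIntegrable (by fun_prop) _ _
  simp only [hprim] at hlc
  have hb : ∀ y, Real.exp (-(u * (φ y : ℝ))) ≤ 1 := fun y => by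
    rw [Real.exp_le_one_iff]
    have : 0 ≤ u * (φ y : ℝ) := by positivity
    linarith
  have hme : Measurable (fun y => Real.exp (-(u * (φ y : ℝ)))) := by fun_prop
  have hint : Integrable (fun y => Real.exp (-(u * (φ y : ℝ)))) μ := by
    refine Integrable.of_bound hme.aestronglyMeasurable 1 (ae_of_all _ fun y => ?_)
    rw [Real.norm_eq_abs, abs_of_pos (Real.exp_pos _)]; exact hb y
  have e1 : 1 - ∫ y, Real.exp (-(u * (φ y : ℝ))) ∂μ = ∫ y, (1 - Real.exp (-(u * (φ y : ℝ)))) ∂μ := by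
    rw [integral_sub (integrable_const _) hint]; simp
  have hanti : Antitone (fun x : ℝ => (μ {y | x < (φ y : ℝ)}).toReal) := by
    intro a b hab
    refine ENNReal.toReal_mono (measure_ne_top _ _) (measure_mono fun y hy => ?_)
    exact lt_of_le_of_lt hab hy
  rw [e1, integral_eq_lintegral_of_nonneg_ae (ae_of_all _ fun y => by
      have := hb y; simp only [Pi.zero_apply]; linarith) (hme.const_sub 1).aestronglyMeasurable, hlc,
    ← integral_const_mul, integral_eq_lintegral_of_nonneg_ae (ae_of_all _ fun y => by
      simp only [Pi.zero_apply]; positivity)]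
  · congr 1
    apply lintegral_congr
    intro x
    rw [mul_one, ← mul_assoc, mul_comm,
      ENNReal.ofReal_mul (p := u * Real.exp (-(u * x))) (by positivity),
      ENNReal.ofReal_toReal (measure_ne_top _ _)]
  · exact (((by fun_prop : Measurable (fun x : ℝ => Real.exp (-(u * x)) * 1)).mul
      hanti.measurable).const_mul u).aestronglyMeasurable

theorem abelian_laplace_asymptotics
    {Y : Type*} [MeasurableSpace Y] (μ : Measure Y) [IsProbabilityMeasure μ]
    (φ : Y → ℕ) (hφmeas : Measurable φ) (hφpos : ∀ y, 1 ≤ φ y)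
    (l : ℝ → ℝ) (hl : SlowlyVarying l) (β : ℝ) (hβ1 : 0 < β) (hβ2 : β < 1)
    (htail : ∀ n : ℕ, 1 ≤ n → (μ {y | n < φ y}).toReal = l n * (n : ℝ) ^ (-β))
    (u₀ : ℝ) (hu₀ : 0 < u₀)
    (g : ℝ → ℝ → ℝ)
    (hg_meas : ∀ u : ℝ, 0 < u → u < u₀ → Measurable (g u))
    (hg_sup : ∀ δ : ℝ, 0 < δ → ∃ u₁ : ℝ, 0 < u₁ ∧
      ∀ u : ℝ, 0 < u → u < u₁ → ∀ x : ℝ, 0 ≤ x → |g u x - 1| ≤ δ) :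
    Tendsto (fun u : ℝ =>
        (u * ∫ x in Set.Ioi (0 : ℝ),
            Real.exp (-(u * x)) * g u x * (μ {y | x < (φ y : ℝ)}).toReal)
          / (Real.Gamma (1 - β) * l (1 / u) * u ^ β))
      (𝓝[>] (0 : ℝ)) (𝓝 1) ∧
    Tendsto (fun u : ℝ =>
        (1 - ∫ y, Real.exp (-(u * (φ y : ℝ))) ∂μ)
          / (Real.Gamma (1 - β) * l (1 / u) * u ^ β))
      (𝓝[>] (0 : ℝ)) (𝓝 1) := by
  let T : ℝ → ℝ := fun x => (μ {y | x < (φ y : ℝ)}).toReal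
  have hT : Antitone T := by
    intro a b hab
    refine ENNReal.toReal_mono (measure_ne_top _ _) (measure_mono fun y hy => ?_)
    exact lt_of_le_of_lt hab hy
  have hT1 : ∀ x, T x ≤ 1 := fun x => measureReal_le_one
  have hfl : ∀ x : ℝ, 1 ≤ x → T x = l (⌊x⌋₊ : ℝ) * (⌊x⌋₊ : ℝ) ^ (-β) := by
    intro x hx
    rw [← htail _ ((Nat.one_le_floor_iff _).2 hx)]
    simp only [T]
    congr 2
    ext y
    simp only [Set.mem_setOf_eq]
    exact (Nat.floor_lt (by linarith)).symm
  have hTpos : ∀ x, 0 < T x := by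
    intro x
    have hf : (1:ℝ) ≤ (⌊max x 1⌋₊ : ℝ) := by
      exact_mod_cast (Nat.one_le_floor_iff _).2 (le_max_right x 1)
    have h2 : 0 < T (max x 1) := by
      rw [hfl _ (le_max_right _ _)]
      have := sv_pos hl (x := (⌊max x 1⌋₊ : ℝ)) (by linarith)
      positivity
    exact lt_of_lt_of_le h2 (hT (le_max_left _ _))
  -- `T x / (l x * x ^ (-β)) → 1`
  have hR : Tendsto (fun x : ℝ => T x / (l x * x ^ (-β))) atTop (𝓝 1) := by
    have a1 := (sv_floor hl).inv₀ one_ne_zero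
    have a2 : Tendsto (fun x : ℝ => ((⌊x⌋₊ : ℝ) / x) ^ (-β)) atTop (𝓝 1) := by
      have := (tendsto_nat_floor_div_atTop (R := ℝ)).rpow_const (p := -β) (Or.inl one_ne_zero)
      simpa using this
    have a3 := a1.mul a2
    simp only [inv_one, mul_one] at a3
    refine a3.congr' ?_
    filter_upwards [eventually_ge_atTop 1] with x hx
    rw [hfl x hx, Real.div_rpow (by positivity) (by positivity), inv_div]
    rw [div_mul_div_comm]
  have hreg : ∀ y, 0 < y → Tendsto (fun x => T (y * x) / T x) atTop (𝓝 (y ^ (-β))) := by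
    intro y hy
    have b1 := hR.comp (tendsto_id.const_mul_atTop hy)
    have b2 := ((b1.mul (hR.inv₀ one_ne_zero)).mul (hl.2.2 y hy)).mul_const (y ^ (-β))
    simp only [inv_one, mul_one, one_mul] at b2
    refine b2.congr' ?_
    filter_upwards [eventually_ge_atTop 1] with x hx
    have hx0 : 0 < x := by linarith
    have c1 := sv_pos hl hx0
    have c2 := sv_pos hl (mul_pos hy hx0)
    have c3 := hTpos x
    have c4 : 0 < x ^ (-β) := by positivity
    have c5 : 0 < y ^ (-β) := by positivity
    simp only [Function.comp, id]
    rw [Real.mul_rpow hy.le hx0.le]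
    field_simp
  have hinv : Tendsto (fun u : ℝ => 1 / u) (𝓝[>] (0 : ℝ)) atTop := by
    simpa using tendsto_inv_nhdsGT_zero (𝕜 := ℝ)
  have hGam : 0 < Real.Gamma (1 - β) := Real.Gamma_pos_of_pos (by linarith)
  have main : ∀ F : ℝ → ℝ, Tendsto (fun u => F u / T (1/u)) (𝓝[>] (0 : ℝ))
      (𝓝 (Real.Gamma (1 - β))) →
      Tendsto (fun u : ℝ => F u / (Real.Gamma (1 - β) * l (1 / u) * u ^ β))
        (𝓝[>] (0 : ℝ)) (𝓝 1) := by
    intro F hF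
    have d1 := (hF.mul (hR.comp hinv)).div_const (Real.Gamma (1 - β))
    rw [mul_one, div_self hGam.ne'] at d1
    refine d1.congr' ?_
    filter_upwards [self_mem_nhdsWithin] with u hu
    have hu : 0 < u := hu
    have c1 := sv_pos hl (one_div_pos.2 hu)
    have c3 := hTpos (1/u)
    have c4 : (1 / u) ^ (-β) = u ^ β := by
      rw [one_div, Real.inv_rpow hu.le, Real.rpow_neg hu.le, inv_inv]
    simp only [Function.comp]
    rw [c4]
    have c5 : 0 < u ^ β := by positivity
    generalize T (1/u) = t at *
    generalize l (1/u) = r at *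
    field_simp
  refine ⟨main _ (core T hT hTpos hT1 β hβ1 hβ2 hreg u₀ hu₀ g hg_meas hg_sup), main _ ?_⟩
  refine (core T hT hTpos hT1 β hβ1 hβ2 hreg 1 one_pos (fun _ _ => 1)
    (fun _ _ _ => measurable_const) (fun δ hδ => ⟨1, one_pos, fun u _ _ x _ => ?_⟩)).congr' ?_
  · simpa using hδ.le
  · filter_upwards [self_mem_nhdsWithin] with u hu
    rw [laplace_tail μ φ hφmeas u hu]
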